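/- Let n ≥ 20 and let 2 ≤ k ≤ n/2. Let A_{n−k}×A_k denote the subgroup of S_n consisting of permutations g that map the block {1,…,n−k} to itself and whose restrictions to {1,…,n−k} and to {n−k+1,…,n} are both even permutations. Then the permutation character of S_n on the cosets of A_{n−k}×A_k is multiplicity-free if and only if 3 ≤ k and 2k + 2 ≤ n (that is, k < (n−1)/2). -/

import Mathlib

noncomputable def IsMultFree {G : Type} [Group G] (H : Subgroup G) : Prop :=
  ∀ V : FDRep ℂ G, CategoryTheory.Simple V →
    Module.finrank ℂ (Representation.invariants (V.ρ.comp H.subtype)) ≤ 1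

/-- The subgroup of permutations of `α` mapping the set defined by `p` to itself. -/
def blockStab {α : Type*} (p : α → Prop) : Subgroup (Equiv.Perm α) where
  carrier := {g | ∀ i : α, p i ↔ p (g i)}
  one_mem' := by intro i; simp
  mul_mem' := by
    intro a b ha hb i
    simpa [Equiv.Perm.mul_apply] using (hb i).trans (ha (b i))
  inv_mem' := by
    intro g hg i
    simpa using (hg (g⁻¹ i)).symm

/-- Restriction of a block-preserving permutation to the block `{i // p i}`. -/
def restrictBlock {α : Type*} (p : α → Prop) : blockStab p →* Equiv.Perm {i // p i} where
  toFun g := Equiv.Perm.subtypePerm g.1 (fun i => (g.2 i).symm)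
  map_one' := by
    ext i
    simp [Equiv.Perm.subtypePerm]
  map_mul' a b := by
    ext i
    simp [Equiv.Perm.subtypePerm, Equiv.Perm.mul_apply]

/-- Restriction of a block-preserving permutation to the complementary block `{i // ¬ p i}`. -/
def restrictCoblock {α : Type*} (p : α → Prop) : blockStab p →* Equiv.Perm {i // ¬ p i} where
  toFun g := Equiv.Perm.subtypePerm g.1 (fun i => not_congr (g.2 i).symm)
  map_one' := by
    ext i
    simp [Equiv.Perm.subtypePerm]
  map_mul' a b := by
    ext i
    simp [Equiv.Perm.subtypePerm, Equiv.Perm.mul_apply]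

/-- The subgroup of permutations of `α` mapping the set defined by `p` to itself and
restricting to even permutations of both `{i // p i}` and its complement. -/
def evenEven {α : Type*} [Fintype α] [DecidableEq α] (p : α → Prop) [DecidablePred p] :
    Subgroup (Equiv.Perm α) :=
  ((Equiv.Perm.sign.comp (restrictBlock p)).ker ⊓
      (Equiv.Perm.sign.comp (restrictCoblock p)).ker).map (blockStab p).subtype

open CategoryTheory in
theorem FDRep.eq_bot_or_eq_top_of_simple {G : Type} [Group G] (V : FDRep ℂ G) (hV : Simple V)
    (W : Submodule ℂ V) (hW : ∀ g, ∀ w ∈ W, V.ρ g w ∈ W) : W = ⊥ ∨ W = ⊤ := by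
  let σ : Representation ℂ G W :=
    { toFun := fun g => (V.ρ g).restrict (hW g)
      map_one' := by ext; simp
      map_mul' := by intros; ext; simp }
  let f : FDRep.of σ ⟶ V :=
    { hom := InducedCategory.homMk (ModuleCat.ofHom W.subtype)
      comm := by intro g; rfl }
  have hf : ∀ w : W, f w = (w : V) := fun _ => rfl
  have : Mono f := ConcreteCategory.mono_of_injective f Subtype.val_injective
  by_cases h0 : f = 0
  · left
    rw [Submodule.eq_bot_iff]
    intro x hx
    have := hf ⟨x, hx⟩
    rw [h0] at this
    exact this.symm
  · right
    have : IsIso f := isIso_of_mono_of_nonzero h0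
    rw [Submodule.eq_top_iff']
    intro x
    have h : f (inv f x) = x := by
      rw [← ConcreteCategory.comp_apply]; simp
    rw [← h, hf]
    exact Subtype.property _

open CategoryTheory in
theorem FDRep.simple_of_forall_eq_bot_or_eq_top {G : Type} [Group G] [Finite G] {V : Type}
    [AddCommGroup V] [Module ℂ V] [Module.Finite ℂ V] [Nontrivial V] (ρ : Representation ℂ G V)
    (h : ∀ W : Submodule ℂ V, (∀ g, ∀ w ∈ W, ρ g w ∈ W) → W = ⊥ ∨ W = ⊤) :
    Simple (FDRep.of ρ) := by
  have : NeZero (Nat.card G : ℂ) := ⟨by exact_mod_cast Nat.card_pos.ne'⟩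
  rw [FDRep.simple_iff_end_is_rank_one]
  have h1 : 𝟙 (FDRep.of ρ) ≠ 0 := by
    intro h0
    obtain ⟨v, hv⟩ := exists_ne (0 : V)
    apply hv
    have : (𝟙 (FDRep.of ρ) : FDRep.of ρ ⟶ _) v = (0 : FDRep.of ρ ⟶ FDRep.of ρ) v := by rw [h0]
    exact this
  refine (finrank_eq_one_iff_of_nonzero' _ h1).2 fun f => ?_
  let F : V →ₗ[ℂ] V := f.hom.hom.hom
  have hF : ∀ g v, F (ρ g v) = ρ g (F v) := by
    intro g v
    exact ConcreteCategory.congr_hom (f.comm g) v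
  obtain ⟨c, hc⟩ := Module.End.exists_eigenvalue F
  refine ⟨c, ?_⟩
  have hW := h (Module.End.eigenspace F c) (by
    intro g w hw
    rw [Module.End.mem_eigenspace_iff] at hw ⊢
    rw [hF, hw, map_smul])
  have hW' := hW.resolve_left hc
  apply Action.Hom.ext
  ext v
  have : v ∈ Module.End.eigenspace F c := hW' ▸ Submodule.mem_top
  exact (Module.End.mem_eigenspace_iff.1 this).symm

theorem MonoidAlgebra.eq_zero_of_forall_simple {G : Type} [Group G] [Finite G]
    (x : MonoidAlgebra ℂ G)
    (hx : ∀ V : FDRep ℂ G, CategoryTheory.Simple V →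
      Representation.asAlgebraHom V.ρ x = 0) : x = 0 := by
  have : NeZero (Nat.card G : ℂ) := ⟨by exact_mod_cast Nat.card_pos.ne'⟩
  have hj := IsSemisimpleRing.jacobson_eq_bot (MonoidAlgebra ℂ G)
  rw [← Submodule.mem_bot (R := MonoidAlgebra ℂ G), ← hj, Ring.jacobson, Module.jacobson,
    Submodule.mem_sInf]
  intro I hI
  let M := MonoidAlgebra ℂ G ⧸ I
  have : IsSimpleModule (MonoidAlgebra ℂ G) M := isSimpleModule_iff_isCoatom.2 hI
  have : Module.Finite ℂ (MonoidAlgebra ℂ G) := inferInstance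
  have : Module.Finite ℂ M := inferInstance
  have : Nontrivial M := IsSimpleModule.nontrivial (MonoidAlgebra ℂ G) M
  let ρ : Representation ℂ G M := Representation.ofModule' M
  have hρ : ∀ y (m : M), Representation.asAlgebraHom ρ y m = y • m := by
    intro y m
    simp [ρ, Representation.ofModule', Representation.asAlgebraHom]
  have hs : CategoryTheory.Simple (FDRep.of ρ) := by
    apply FDRep.simple_of_forall_eq_bot_or_eq_top
    intro W hW
    let W' : Submodule (MonoidAlgebra ℂ G) M :=
      { W with
        smul_mem' := by
          intro y m hm
          rw [← hρ]
          induction y using MonoidAlgebra.induction_linear with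
          | zero => simp
          | add a b ha hb => rw [map_add]; exact W.add_mem ha hb
          | single g r => simpa using W.smul_mem r (hW g m hm) }
    rcases eq_bot_or_eq_top W' with h | h
    · left; ext y; exact SetLike.ext_iff.1 h y
    · right; ext y; exact SetLike.ext_iff.1 h y
  have h0 := hx _ hs
  have h1 := hρ x (Submodule.Quotient.mk 1)
  have h2 : Representation.asAlgebraHom ρ x = 0 := h0
  rw [h2, ← Submodule.Quotient.mk_smul, smul_eq_mul, mul_one] at h1
  exact (Submodule.Quotient.mk_eq_zero I).1 h1.symm

theorem LinearMap.sandwich_comm_of_finrank_le_one {V : Type*} [AddCommGroup V] [Module ℂ V]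
    [Module.Finite ℂ V] (W : Submodule ℂ V) (hW : Module.finrank ℂ W ≤ 1) (S A B : Module.End ℂ V)
    (hS : ∀ v, S v ∈ W) : S * A * S * B * S = S * B * S * A * S := by
  obtain ⟨w, hw⟩ := finrank_le_one_iff.1 hW
  have key : ∀ v, ∃ c : ℂ, S v = c • (w : V) := fun v => by
    obtain ⟨c, hc⟩ := hw ⟨S v, hS v⟩
    exact ⟨c, by simpa using (congrArg Subtype.val hc).symm⟩
  ext v
  obtain ⟨a, ha⟩ := key (A w)
  obtain ⟨b, hb⟩ := key (B w)
  obtain ⟨c, hc⟩ := key v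
  simp only [Module.End.mul_apply, hc, map_smul, ha, hb, smul_smul]
  congr 1
  ring

theorem IsMultFree.exists_mul_eq {G : Type} [Group G] [Finite G] {H : Subgroup G}
    (hH : IsMultFree H) (n g : G) :
    ∃ h₁ ∈ H, ∃ h₂ ∈ H, ∃ h₃ ∈ H, h₁ * g * h₂ * n * h₃ = n * g := by
  classical
  have := Fintype.ofFinite H
  let s : MonoidAlgebra ℂ G := ∑ h : H, MonoidAlgebra.single (h : G) 1
  let u : G → MonoidAlgebra ℂ G := fun x => MonoidAlgebra.single x 1
  have hcomm : s * u n * s * u g * s - s * u g * s * u n * s = 0 := by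
    apply MonoidAlgebra.eq_zero_of_forall_simple
    intro V hV
    rw [map_sub, sub_eq_zero]
    simp only [map_mul]
    apply LinearMap.sandwich_comm_of_finrank_le_one _ (hH V hV)
    intro v
    rw [Representation.mem_invariants]
    intro h
    have hs : u h * s = s := by
      simp only [s, u, Finset.mul_sum, MonoidAlgebra.single_mul_single, one_mul]
      exact Fintype.sum_equiv (Equiv.mulLeft h) _ _ (fun x => by simp)
    have := congrArg (fun y => Representation.asAlgebraHom V.ρ y v) hs
    simpa [u] using this
  have hexp : ∀ a b : G, (s * u a * s * u b * s).coeff (n * g) =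
      ((∑ h₁ : H, ∑ h₂ : H, ∑ h₃ : H,
        if (h₁ * a * h₂ * b * h₃ : G) = n * g then 1 else 0 : ℕ) : ℂ) := by
    intro a b
    simp only [s, u, Finset.sum_mul, Finset.mul_sum, MonoidAlgebra.single_mul_single, one_mul,
      MonoidAlgebra.coeff_sum, Finsupp.finsetSum_apply, MonoidAlgebra.coeff_single,
      Finsupp.single_apply, Nat.cast_sum, Nat.cast_ite, Nat.cast_one, Nat.cast_zero]
    rw [Finset.sum_comm_cycle]
    refine Finset.sum_congr rfl fun _ _ => ?_
    rw [Finset.sum_comm]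
  by_contra! hne
  have h1 := congrArg (fun y => y.coeff (n * g)) (sub_eq_zero.1 hcomm)
  simp only [hexp, Nat.cast_inj] at h1
  rw [Finset.sum_eq_zero (s := Finset.univ) (f := fun h₁ : H => ∑ h₂ : H, ∑ h₃ : H,
        if (h₁ * g * h₂ * n * h₃ : G) = n * g then 1 else 0)] at h1
  · simp only [Finset.sum_eq_zero_iff] at h1
    simpa using h1 1 (Finset.mem_univ _) 1 (Finset.mem_univ _) 1 (Finset.mem_univ _)
  · intro h₁ _
    refine Finset.sum_eq_zero fun h₂ _ => Finset.sum_eq_zero fun h₃ _ => ?_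
    rw [if_neg (hne h₁ h₁.2 h₂ h₂.2 h₃ h₃.2)]

/-- The unnormalised isotypic projector of a sign-valued character of a subgroup. -/
noncomputable def charSum {G : Type*} [Group G] {N : Subgroup G} [Fintype N] {V : Type*}
    [AddCommGroup V] [Module ℂ V] (ρ : Representation ℂ G V) (χ : N →* ℤˣ) : Module.End ℂ V :=
  ∑ x : N, ((χ x : ℤ) : ℂ) • ρ x

section charSum

variable {G : Type*} [Group G] {N : Subgroup G} [Fintype N] {V : Type*}
  [AddCommGroup V] [Module ℂ V] (ρ : Representation ℂ G V) (χ χ' : N →* ℤˣ)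

theorem Int.units_coe_mul_self_complex (u : ℤˣ) : ((u : ℤ) : ℂ) * ((u : ℤ) : ℂ) = 1 := by
  rcases Int.units_eq_one_or u with rfl | rfl <;> simp

theorem charSum_mul (x : N) : charSum ρ χ * ρ x = ((χ x : ℤ) : ℂ) • charSum ρ χ := by
  simp only [charSum, Finset.sum_mul, Finset.smul_sum, smul_mul_assoc, ← map_mul, smul_smul]
  refine Fintype.sum_equiv (Equiv.mulRight x) _ _ fun y => ?_
  simp only [Equiv.coe_mulRight, map_mul, Subgroup.coe_mul, Units.val_mul, Int.cast_mul]
  rw [mul_comm, mul_assoc, Int.units_coe_mul_self_complex, mul_one]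

theorem mul_charSum (x : N) : ρ x * charSum ρ χ = ((χ x : ℤ) : ℂ) • charSum ρ χ := by
  simp only [charSum, Finset.mul_sum, Finset.smul_sum, mul_smul_comm, ← map_mul, smul_smul]
  refine Fintype.sum_equiv (Equiv.mulLeft x) _ _ fun y => ?_
  simp only [Equiv.coe_mulLeft, map_mul, Subgroup.coe_mul, Units.val_mul, Int.cast_mul]
  rw [← mul_assoc, Int.units_coe_mul_self_complex, one_mul]

theorem charSum_mul_mul_charSum_eq_zero (g : G) (t : N) (ht : g⁻¹ * t * g ∈ N)
    (h : χ' t ≠ χ ⟨_, ht⟩) : charSum ρ χ' * ρ g * charSum ρ χ = 0 := by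
  have h1 : charSum ρ χ' * ρ t * ρ g * charSum ρ χ =
      charSum ρ χ' * ρ g * (ρ (g⁻¹ * t * g) * charSum ρ χ) := by
    simp only [mul_assoc, ← map_mul]
    simp only [← mul_assoc (ρ _) (ρ _), ← map_mul]
    group
  have h2 := mul_charSum ρ χ ⟨_, ht⟩
  simp only at h2
  rw [charSum_mul, h2] at h1
  simp only [smul_mul_assoc, mul_smul_comm] at h1
  rw [← sub_eq_zero, ← sub_smul, smul_eq_zero] at h1
  refine h1.resolve_left fun h0 => h ?_
  rw [sub_eq_zero] at h0
  exact Units.ext (by exact_mod_cast h0)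

theorem charSum_mul_inv_mul_charSum (hinv : ∀ g : G, ∃ m ∈ N, (g * m) * (g * m) = 1) (g : G) :
    charSum ρ χ * ρ g⁻¹ * charSum ρ χ = charSum ρ χ * ρ g * charSum ρ χ := by
  obtain ⟨m, hm, h⟩ := hinv g
  have hg : g⁻¹ = m * g * m := by
    rw [inv_eq_iff_mul_eq_one]
    simpa [mul_assoc] using h
  have h1 := charSum_mul ρ χ ⟨m, hm⟩
  have h2 := mul_charSum ρ χ ⟨m, hm⟩
  simp only at h1 h2
  calc charSum ρ χ * ρ g⁻¹ * charSum ρ χ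
      = (charSum ρ χ * ρ m) * ρ g * (ρ m * charSum ρ χ) := by
        rw [hg]; simp only [map_mul, mul_assoc]
    _ = _ := by
        rw [h1, h2]
        simp only [smul_mul_assoc, mul_smul_comm, smul_smul, Int.units_coe_mul_self_complex,
          one_smul]

theorem charSum_sandwich_comm (hinv : ∀ g : G, ∃ m ∈ N, (g * m) * (g * m) = 1) (g h : G) :
    charSum ρ χ * ρ g * charSum ρ χ * ρ h * charSum ρ χ =
      charSum ρ χ * ρ h * charSum ρ χ * ρ g * charSum ρ χ := by
  have expand : ∀ a b : G, charSum ρ χ * ρ a * charSum ρ χ * ρ b * charSum ρ χ =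
      ∑ x : N, ((χ x : ℤ) : ℂ) • (charSum ρ χ * ρ (a * x * b) * charSum ρ χ) := by
    intro a b
    have mid : charSum ρ χ * ρ a * (∑ x : N, ((χ x : ℤ) : ℂ) • ρ x) * ρ b * charSum ρ χ =
        ∑ x : N, ((χ x : ℤ) : ℂ) • (charSum ρ χ * ρ (a * x * b) * charSum ρ χ) := by
      generalize charSum ρ χ = E
      simp only [Finset.mul_sum, Finset.sum_mul, smul_mul_assoc, mul_smul_comm, map_mul, mul_assoc]
    exact mid
  calc charSum ρ χ * ρ g * charSum ρ χ * ρ h * charSum ρ χ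
      = charSum ρ χ * ρ h⁻¹ * charSum ρ χ * ρ g⁻¹ * charSum ρ χ := by
        rw [expand, expand]
        refine Fintype.sum_equiv (Equiv.inv N) _ _ fun x => ?_
        rw [← charSum_mul_inv_mul_charSum ρ χ hinv (g * x * h)]
        simp [mul_assoc]
    _ = charSum ρ χ * ρ h * (charSum ρ χ * ρ g⁻¹ * charSum ρ χ) := by
        rw [charSum_mul_inv_mul_charSum ρ χ hinv h]
        simp only [mul_assoc]
    _ = _ := by
        rw [charSum_mul_inv_mul_charSum ρ χ hinv g]
        simp only [mul_assoc]

end charSum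

section irreducible

variable {G : Type*} [Group G] {N : Subgroup G} [Fintype N] {V : Type*}
  [AddCommGroup V] [Module ℂ V] (ρ : Representation ℂ G V) (χ χ' : N →* ℤˣ)

theorem Representation.span_orbit_eq_top
    (hirr : ∀ W : Submodule ℂ V, (∀ g, ∀ w ∈ W, ρ g w ∈ W) → W = ⊥ ∨ W = ⊤)
    {v : V} (hv : v ≠ 0) : Submodule.span ℂ (Set.range fun g => ρ g v) = ⊤ := by
  refine (hirr _ fun g w hw => ?_).resolve_left fun h => hv ?_
  · induction hw using Submodule.span_induction with
    | mem x hx =>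
      obtain ⟨a, rfl⟩ := hx
      exact Submodule.subset_span ⟨g * a, by simp⟩
    | zero => simp
    | add x y _ _ hx hy => rw [map_add]; exact add_mem hx hy
    | smul c x _ hx => rw [map_smul]; exact Submodule.smul_mem _ _ hx
  · rw [Submodule.span_eq_bot] at h
    exact h v ⟨1, by simp⟩

theorem charSum_eq_zero_of_ne_zero
    (hirr : ∀ W : Submodule ℂ V, (∀ g, ∀ w ∈ W, ρ g w ∈ W) → W = ⊥ ∨ W = ⊤)
    (hsep : ∀ g : G, ∃ t : N, ∃ ht : g⁻¹ * t * g ∈ N, χ' t ≠ χ ⟨_, ht⟩)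
    (h : charSum ρ χ ≠ 0) : charSum ρ χ' = 0 := by
  obtain ⟨v, hv⟩ : ∃ v, charSum ρ χ v ≠ 0 := by
    by_contra! hc
    exact h (LinearMap.ext hc)
  refine LinearMap.ext_on_range (Representation.span_orbit_eq_top ρ hirr hv) fun g => ?_
  obtain ⟨t, ht, hne⟩ := hsep g
  exact LinearMap.congr_fun (charSum_mul_mul_charSum_eq_zero ρ χ χ' g t ht hne) v

theorem exists_charSum_eq_smul [Module.Finite ℂ V]
    (hirr : ∀ W : Submodule ℂ V, (∀ g, ∀ w ∈ W, ρ g w ∈ W) → W = ⊥ ∨ W = ⊤)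
    (hinv : ∀ g : G, ∃ m ∈ N, (g * m) * (g * m) = 1) :
    ∃ w : V, ∀ v, ∃ c : ℂ, charSum ρ χ v = c • w := by
  by_cases h0 : charSum ρ χ = 0
  · exact ⟨0, fun v => ⟨0, by simp [h0]⟩⟩
  obtain ⟨v₀, hv₀⟩ : ∃ v, charSum ρ χ v ≠ 0 := by
    by_contra! hc
    exact h0 (LinearMap.ext hc)
  have hscalar : ∀ g : G, ∃ c : ℂ, ∀ v,
      (charSum ρ χ * ρ g * charSum ρ χ) v = c • charSum ρ χ v := by
    intro g
    set E := charSum ρ χ with hE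
    let T : Module.End ℂ (LinearMap.range E) :=
      (E * ρ g).restrict fun x _ => ⟨ρ g x, rfl⟩
    have : Nontrivial (LinearMap.range E) :=
      ⟨⟨⟨E v₀, v₀, rfl⟩, 0, fun h => hv₀ (congrArg Subtype.val h)⟩⟩
    obtain ⟨c, hc⟩ := Module.End.exists_eigenvalue T
    obtain ⟨⟨_, u, rfl⟩, hu⟩ := hc.exists_hasEigenvector
    have hu0 : E u ≠ 0 := fun h => hu.2 (Subtype.ext h)
    have hu1 : E (ρ g (E u)) = c • E u := congrArg Subtype.val hu.apply_eq_smul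
    refine ⟨c, fun v => ?_⟩
    have key : (E * ρ g) ∘ₗ E = c • E := by
      refine LinearMap.ext_on_range (Representation.span_orbit_eq_top ρ hirr hu0) fun h => ?_
      have := LinearMap.congr_fun (charSum_sandwich_comm ρ χ hinv g h) u
      rw [← hE] at this
      simp only [Module.End.mul_apply] at this
      simp only [LinearMap.comp_apply, Module.End.mul_apply, LinearMap.smul_apply, this, hu1,
        map_smul]
    exact LinearMap.congr_fun key v
  refine ⟨charSum ρ χ v₀, fun v => ?_⟩
  have hv : v ∈ Submodule.span ℂ (Set.range fun g => ρ g (charSum ρ χ v₀)) := by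
    rw [Representation.span_orbit_eq_top ρ hirr hv₀]; trivial
  induction hv using Submodule.span_induction with
  | mem x hx =>
    obtain ⟨g, rfl⟩ := hx
    obtain ⟨c, hc⟩ := hscalar g
    exact ⟨c, hc v₀⟩
  | zero => exact ⟨0, by simp⟩
  | add x y _ _ hx hy =>
    obtain ⟨a, ha⟩ := hx
    obtain ⟨b, hb⟩ := hy
    exact ⟨a + b, by rw [map_add, ha, hb, add_smul]⟩
  | smul c x _ hx =>
    obtain ⟨a, ha⟩ := hx
    exact ⟨c * a, by rw [map_smul, ha, mul_smul]⟩

end irreducible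

theorem isMultFree_of_sign_characters {G : Type} [Group G] [Finite G] {H N : Subgroup G}
    (α β : N →* ℤˣ) (hH : ∀ g : G, g ∈ H ↔ ∃ h : g ∈ N, α ⟨g, h⟩ = 1 ∧ β ⟨g, h⟩ = 1)
    (hinv : ∀ g : G, ∃ m ∈ N, (g * m) * (g * m) = 1)
    (hsep : ∀ a b a' b' : Fin 2, (a, b) ≠ (a', b') → ∀ g : G, ∃ t : N, ∃ ht : g⁻¹ * t * g ∈ N,
      (α ^ (a' : ℕ) * β ^ (b' : ℕ)) t ≠ (α ^ (a : ℕ) * β ^ (b : ℕ)) ⟨_, ht⟩) :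
    IsMultFree H := by
  classical
  have := Fintype.ofFinite N
  intro V hV
  have hirr := FDRep.eq_bot_or_eq_top_of_simple V hV
  let χ : Fin 2 × Fin 2 → (N →* ℤˣ) := fun p => α ^ (p.1 : ℕ) * β ^ (p.2 : ℕ)
  have hcard : ((Nat.card H : ℂ)) ≠ 0 := by exact_mod_cast Nat.card_pos.ne'
  have hsum : ∀ v ∈ Representation.invariants (V.ρ.comp H.subtype),
      ∑ p, charSum V.ρ (χ p) v = (4 * Nat.card H : ℂ) • v := by
    intro v hv
    simp only [charSum, LinearMap.sum_apply, LinearMap.smul_apply]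
    rw [Finset.sum_comm]
    simp only [← Finset.sum_smul]
    have h1 : ∀ x : N, (∑ p, (((χ p) x : ℤ) : ℂ)) • V.ρ x v =
        if (x : G) ∈ H then (4 : ℂ) • v else 0 := by
      intro x
      have hx : (x : G) ∈ H ↔ α x = 1 ∧ β x = 1 := by simp [hH]
      rw [Fintype.sum_prod_type]
      simp only [χ, Fin.sum_univ_two, Fin.val_zero, Fin.val_one, pow_zero, pow_one, one_mul,
        mul_one, MonoidHom.mul_apply, MonoidHom.one_apply]
      split_ifs with h
      · rw [show V.ρ x v = v from hv ⟨x, h⟩, (hx.1 h).1, (hx.1 h).2]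
        norm_num
      · rw [hx] at h
        generalize α x = a at h
        generalize β x = b at h
        suffices hz : ((1 : ℤˣ) : ℤ) + ((b : ℤ) : ℂ) + (((a : ℤ) : ℂ) + ((a * b : ℤˣ) : ℤ)) = 0 by
          rw [hz, zero_smul]
        rcases Int.units_eq_one_or a with rfl | rfl <;>
          rcases Int.units_eq_one_or b with rfl | rfl
        · exact absurd ⟨rfl, rfl⟩ h
        all_goals norm_num
    rw [Finset.sum_congr rfl fun x _ => h1 x, ← Finset.sum_filter, Finset.sum_const,
      ← Nat.cast_smul_eq_nsmul ℂ, smul_smul, mul_comm]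
    congr 2
    norm_cast
    rw [← Fintype.card_subtype, ← Nat.card_eq_fintype_card]
    refine Nat.card_congr ⟨fun x => ⟨x.1, x.2⟩, fun x => ⟨⟨x, ((hH x).1 x.2).1⟩, x.2⟩,
      fun _ => rfl, fun _ => rfl⟩
  obtain ⟨p₀, hp₀⟩ : ∃ p₀, ∀ p, p ≠ p₀ → charSum V.ρ (χ p) = 0 := by
    by_cases h : ∃ p₀, charSum V.ρ (χ p₀) ≠ 0
    · obtain ⟨p₀, h⟩ := h
      exact ⟨p₀, fun p hp => charSum_eq_zero_of_ne_zero V.ρ (χ p₀) (χ p) hirr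
        (hsep p₀.1 p₀.2 p.1 p.2 hp.symm) h⟩
    · push Not at h
      exact ⟨0, fun p _ => h p⟩
  obtain ⟨w, hw⟩ := exists_charSum_eq_smul V.ρ (χ p₀) hirr hinv
  have hle : Representation.invariants (V.ρ.comp H.subtype) ≤ Submodule.span ℂ {w} := by
    intro v hv
    rw [Submodule.mem_span_singleton]
    obtain ⟨c, hc⟩ := hw v
    have h1 := hsum v hv
    rw [Finset.sum_eq_single p₀ (fun p _ hp => by simp [hp₀ p hp]) (by simp), hc] at h1
    refine ⟨(4 * Nat.card H : ℂ)⁻¹ * c, ?_⟩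
    rw [mul_smul, h1, inv_smul_smul₀ (mul_ne_zero (by norm_num) hcard)]
  exact (Submodule.finrank_mono hle).trans
    ((finrank_span_le_card ({w} : Set V)).trans (by simp))

section blockStab

open Equiv

variable {α : Type*} {p : α → Prop}

theorem mem_evenEven [Fintype α] [DecidableEq α] [DecidablePred p] {g : Perm α} :
    g ∈ evenEven p ↔ ∃ h : g ∈ blockStab p,
      Perm.sign.comp (restrictBlock p) ⟨g, h⟩ = 1 ∧
        Perm.sign.comp (restrictCoblock p) ⟨g, h⟩ = 1 := by
  simp [evenEven, Subgroup.mem_map, MonoidHom.mem_ker]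

theorem exists_involution_mem_blockStab [Fintype α] [DecidableEq α] [DecidablePred p]
    (g : Perm α) : ∃ m ∈ blockStab p, (g * m) * (g * m) = 1 := by
  let P : Finset α := Finset.univ.filter p
  let Q : Finset α := Finset.univ.filter fun x => p (g⁻¹ x)
  have hPQ : P.card = Q.card :=
    Finset.card_bij (fun x _ => g x) (by simp [P, Q]) (by simp)
      (fun y hy => ⟨g⁻¹ y, by simpa [P, Q] using hy, by simp⟩)
  let e : (P \ Q : Finset α) ≃ (Q \ P : Finset α) :=
    Finset.equivOfCardEq (Finset.card_sdiff_comm hPQ)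
  let f : α → α := fun x =>
    if h : x ∈ P \ Q then e ⟨x, h⟩ else if h : x ∈ Q \ P then e.symm ⟨x, h⟩ else x
  have f₁ : ∀ x (h : x ∈ P \ Q), f x = e ⟨x, h⟩ := fun x h => dif_pos h
  have hdisj : ∀ x, x ∈ Q \ P → x ∉ P \ Q := by grind
  have f₂ : ∀ x (h : x ∈ Q \ P), f x = e.symm ⟨x, h⟩ := fun x h => by
    simp only [f, dif_neg (hdisj x h), dif_pos h]
  have f₃ : ∀ x, x ∉ P \ Q → x ∉ Q \ P → f x = x := fun x h h' => by
    simp only [f, dif_neg h, dif_neg h']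
  have hf : Function.Involutive f := by
    intro x
    by_cases h : x ∈ P \ Q
    · rw [f₁ x h, f₂ _ (e ⟨x, h⟩).2]; simp
    by_cases h' : x ∈ Q \ P
    · rw [f₂ x h', f₁ _ (e.symm ⟨x, h'⟩).2]; simp
    rw [f₃ x h h', f₃ x h h']
  have hfPQ : ∀ x, x ∈ P ↔ f x ∈ Q := by
    intro x
    by_cases h : x ∈ P \ Q
    · rw [f₁ x h]
      have := (e ⟨x, h⟩).2
      grind
    by_cases h' : x ∈ Q \ P
    · rw [f₂ x h']
      have := (e.symm ⟨x, h'⟩).2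
      grind
    rw [f₃ x h h']
    grind
  refine ⟨g⁻¹ * hf.toPerm, fun i => by simpa [P, Q] using hfPQ i, ?_⟩
  rw [mul_inv_cancel_left]
  ext x
  simp [hf x]

theorem swap_mem_blockStab [DecidableEq α] {x y : α} (h : p x ↔ p y) :
    swap x y ∈ blockStab p := by
  intro i
  rw [swap_apply_def]
  split_ifs <;> simp_all

theorem sign_restrictBlock_swap [Fintype α] [DecidableEq α] [DecidablePred p] {x y : α}
    (hx : p x) (hy : p y) (hxy : x ≠ y) (h : swap x y ∈ blockStab p) :
    Perm.sign (restrictBlock p ⟨swap x y, h⟩) = -1 := by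
  have : restrictBlock p ⟨swap x y, h⟩ = swap ⟨x, hx⟩ ⟨y, hy⟩ := by
    ext i
    simp only [restrictBlock, MonoidHom.coe_mk, OneHom.coe_mk, Perm.subtypePerm_apply,
      swap_apply_def, Subtype.ext_iff]
    split_ifs <;> rfl
  rw [this, Perm.sign_swap (by simpa using hxy)]

theorem sign_restrictCoblock_swap [Fintype α] [DecidableEq α] [DecidablePred p] {x y : α}
    (hx : ¬ p x) (hy : ¬ p y) (hxy : x ≠ y) (h : swap x y ∈ blockStab p) :
    Perm.sign (restrictCoblock p ⟨swap x y, h⟩) = -1 := by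
  have : restrictCoblock p ⟨swap x y, h⟩ = swap ⟨x, hx⟩ ⟨y, hy⟩ := by
    ext i
    simp only [restrictCoblock, MonoidHom.coe_mk, OneHom.coe_mk, Perm.subtypePerm_apply,
      swap_apply_def, Subtype.ext_iff]
    split_ifs <;> rfl
  rw [this, Perm.sign_swap (by simpa using hxy)]

theorem restrictCoblock_swap [DecidableEq α] {x y : α} (hx : p x) (hy : p y)
    (h : swap x y ∈ blockStab p) : restrictCoblock p ⟨swap x y, h⟩ = 1 := by
  ext i
  have h1 : (i : α) ≠ x := fun h => i.2 (h ▸ hx)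
  have h2 : (i : α) ≠ y := fun h => i.2 (h ▸ hy)
  simp [restrictCoblock, swap_apply_of_ne_of_ne h1 h2]

theorem restrictBlock_swap [DecidableEq α] {x y : α} (hx : ¬ p x) (hy : ¬ p y)
    (h : swap x y ∈ blockStab p) : restrictBlock p ⟨swap x y, h⟩ = 1 := by
  ext i
  have h1 : (i : α) ≠ x := fun h => hx (h ▸ i.2)
  have h2 : (i : α) ≠ y := fun h => hy (h ▸ i.2)
  simp [restrictBlock, swap_apply_of_ne_of_ne h1 h2]

theorem Equiv.Perm.exists_ne_of_card_le [Fintype α] [DecidableEq α] [DecidablePred p] (g : Perm α)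
    (h : 3 ≤ (Finset.univ.filter fun x => ¬ p x).card)
    (h' : (Finset.univ.filter fun x => ¬ p x).card + 2 ≤ (Finset.univ.filter p).card) :
    (∃ x y, x ≠ y ∧ (p x ∧ p (g⁻¹ x)) ∧ p y ∧ p (g⁻¹ y)) ∧
    ((∃ x y, x ≠ y ∧ (¬ p x ∧ ¬ p (g⁻¹ x)) ∧ ¬ p y ∧ ¬ p (g⁻¹ y)) ∨
      ((∃ x y, x ≠ y ∧ (¬ p x ∧ p (g⁻¹ x)) ∧ ¬ p y ∧ p (g⁻¹ y)) ∧
        (∃ x y, x ≠ y ∧ (p x ∧ ¬ p (g⁻¹ x)) ∧ p y ∧ ¬ p (g⁻¹ y)))) := by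
  have hcard : ∀ q : α → Prop, ∀ [DecidablePred q], (∃ x y, x ≠ y ∧ q x ∧ q y) ↔
      2 ≤ (Finset.univ.filter q).card := by
    intro q _
    rw [← Nat.lt_iff_add_one_le, Finset.one_lt_card]
    simp only [Finset.mem_filter, Finset.mem_univ, true_and]
    grind
  have e1 : (Finset.univ.filter fun x => p (g⁻¹ x)).card = (Finset.univ.filter p).card :=
    Finset.card_bij (fun x _ => g⁻¹ x) (by simp) (by simp)
      (fun y hy => ⟨g y, by simpa using hy, by simp⟩)
  have split : ∀ q r : α → Prop, ∀ [DecidablePred q] [DecidablePred r],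
      (Finset.univ.filter fun x => q x ∧ r x).card + (Finset.univ.filter fun x => q x ∧ ¬ r x).card
        = (Finset.univ.filter q).card := by
    intro q r _ _
    rw [← Finset.filter_filter, ← Finset.filter_filter, Finset.card_filter_add_card_filter_not]
  have s1 := split p (fun x => p (g⁻¹ x))
  have s2 := split (fun x => ¬ p x) (fun x => p (g⁻¹ x))
  have s3 : (Finset.univ.filter fun x => p x ∧ p (g⁻¹ x)).card +
      (Finset.univ.filter fun x => ¬ p x ∧ p (g⁻¹ x)).card = (Finset.univ.filter p).card := by
    rw [← e1, ← split (fun x => p (g⁻¹ x)) p]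
    simp only [and_comm]
  rw [hcard fun x => p x ∧ p (g⁻¹ x), hcard fun x => ¬ p x ∧ ¬ p (g⁻¹ x),
    hcard fun x => ¬ p x ∧ p (g⁻¹ x), hcard fun x => p x ∧ ¬ p (g⁻¹ x)]
  omega

theorem isMultFree_evenEven {α : Type} {p : α → Prop} [Fintype α] [DecidableEq α]
    [DecidablePred p] (h : 3 ≤ (Finset.univ.filter fun x => ¬ p x).card)
    (h' : (Finset.univ.filter fun x => ¬ p x).card + 2 ≤ (Finset.univ.filter p).card) :
    IsMultFree (evenEven p) := by
  refine isMultFree_of_sign_characters (Perm.sign.comp (restrictBlock p))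
    (Perm.sign.comp (restrictCoblock p)) (fun g => mem_evenEven)
    exists_involution_mem_blockStab fun a b a' b' hne g => ?_
  have hconj : ∀ x y, g⁻¹ * swap x y * g = swap (g⁻¹ x) (g⁻¹ y) := by
    intro x y
    have := swap_apply_apply g⁻¹ x y
    rw [this, inv_inv]
  obtain ⟨h1, h2⟩ := Perm.exists_ne_of_card_le g h h'
  have take : ∀ x y, (p x ↔ p y) → (p (g⁻¹ x) ↔ p (g⁻¹ y)) →
      (∀ hx hy, Perm.sign (restrictBlock p ⟨swap x y, hx⟩) ^ (a' : ℕ) *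
          Perm.sign (restrictCoblock p ⟨swap x y, hx⟩) ^ (b' : ℕ) ≠
        Perm.sign (restrictBlock p ⟨swap (g⁻¹ x) (g⁻¹ y), hy⟩) ^ (a : ℕ) *
          Perm.sign (restrictCoblock p ⟨swap (g⁻¹ x) (g⁻¹ y), hy⟩) ^ (b : ℕ)) →
      ∃ t : blockStab p, ∃ ht : g⁻¹ * t * g ∈ blockStab p,
        (Perm.sign.comp (restrictBlock p) ^ (a' : ℕ) *
          Perm.sign.comp (restrictCoblock p) ^ (b' : ℕ)) t ≠
        (Perm.sign.comp (restrictBlock p) ^ (a : ℕ) *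
          Perm.sign.comp (restrictCoblock p) ^ (b : ℕ)) ⟨_, ht⟩ := by
    intro x y hxy hxy' hs
    refine ⟨⟨swap x y, swap_mem_blockStab hxy⟩,
      by simpa only [hconj] using swap_mem_blockStab hxy', ?_⟩
    simp only [hconj]
    exact hs (swap_mem_blockStab hxy) (swap_mem_blockStab hxy')
  have hinj : ∀ x y, x ≠ y → g⁻¹ x ≠ g⁻¹ y := fun x y h => g⁻¹.injective.ne h
  by_cases haa : a = a'
  · have hbb : b ≠ b' := fun hb => hne (by rw [haa, hb])
    rcases h2 with ⟨x, y, hxy, hx, hy⟩ | ⟨⟨x, y, hxy, hx, hy⟩, ⟨u, v, huv, hu, hv⟩⟩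
    · refine take x y (by tauto) (by tauto) fun _ _ => ?_
      rw [restrictBlock_swap hx.1 hy.1, restrictBlock_swap hx.2 hy.2,
        sign_restrictCoblock_swap hx.1 hy.1 hxy,
        sign_restrictCoblock_swap hx.2 hy.2 (hinj _ _ hxy)]
      clear take hne
      revert a b a' b'
      simp only [map_one]
      decide
    · by_cases hba : b' = a
      · refine take u v (by tauto) (by tauto) fun _ _ => ?_
        rw [restrictCoblock_swap hu.1 hv.1, restrictBlock_swap hu.2 hv.2,
          sign_restrictBlock_swap hu.1 hv.1 huv,
          sign_restrictCoblock_swap hu.2 hv.2 (hinj _ _ huv)]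
        clear take hne
        revert a b a' b'
        simp only [map_one]
        decide
      · refine take x y (by tauto) (by tauto) fun _ _ => ?_
        rw [restrictBlock_swap hx.1 hy.1, restrictCoblock_swap hx.2 hy.2,
          sign_restrictCoblock_swap hx.1 hy.1 hxy,
          sign_restrictBlock_swap hx.2 hy.2 (hinj _ _ hxy)]
        clear take hne
        revert a b a' b'
        simp only [map_one]
        decide
  · obtain ⟨x, y, hxy, hx, hy⟩ := h1
    refine take x y (by tauto) (by tauto) fun _ _ => ?_
    rw [restrictCoblock_swap hx.1 hy.1, restrictCoblock_swap hx.2 hy.2,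
      sign_restrictBlock_swap hx.1 hy.1 hxy,
      sign_restrictBlock_swap hx.2 hy.2 (hinj _ _ hxy)]
    clear take hne
    revert a b a' b'
    simp only [map_one]
    decide

theorem not_isMultFree_evenEven_of_card_eq_two {α : Type} {p : α → Prop} [Fintype α]
    [DecidableEq α] [DecidablePred p] {a x y : α} (ha : p a) (hx : ¬ p x) (hy : ¬ p y)
    (hxy : x ≠ y) (hp : ∀ z, ¬ p z → z = x ∨ z = y) : ¬ IsMultFree (evenEven p) := by
  intro hmf
  have hfix : ∀ g ∈ evenEven p, g x = x ∧ g y = y := by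
    intro g hg
    obtain ⟨hs, -, h2⟩ := mem_evenEven.1 hg
    have hgx : ¬ p (g x) := by rwa [← hs x]
    have hgy : ¬ p (g y) := by rwa [← hs y]
    have hinj := g.injective.ne hxy
    rcases hp _ hgx with h | h
    · exact ⟨h, (hp _ hgy).resolve_left fun h' => hinj (h.trans h'.symm)⟩
    · exfalso
      have h' : g y = x := (hp _ hgy).resolve_right fun h' => hinj (h.trans h'.symm)
      have : restrictCoblock p ⟨g, hs⟩ = swap ⟨x, hx⟩ ⟨y, hy⟩ := by
        ext ⟨i, hi⟩
        rcases hp i hi with rfl | rfl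
        · simpa [restrictCoblock] using h
        · simpa [restrictCoblock] using h'
      rw [MonoidHom.comp_apply, this, Perm.sign_swap (by simpa using hxy)] at h2
      exact absurd h2 (by decide)
  obtain ⟨h₁, m₁, h₂, m₂, h₃, m₃, h⟩ := hmf.exists_mul_eq (swap x y) (swap a x)
  have hax : a ≠ x := fun h => hx (h ▸ ha)
  have hay : a ≠ y := fun h => hy (h ▸ ha)
  have := Perm.ext_iff.1 h x
  simp only [Perm.mul_apply, (hfix _ m₁).2, (hfix _ m₂).2,
    (hfix _ m₃).1, swap_apply_left, swap_apply_right, swap_apply_of_ne_of_ne hay.symm hxy.symm,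
    swap_apply_of_ne_of_ne hax hay] at this
  exact hay this.symm

theorem not_isMultFree_evenEven_of_swap {α : Type} {p : α → Prop} [Fintype α]
    [DecidableEq α] [DecidablePred p] (g : Perm α)
    (hg : ∀ x, ¬ p x → p (g⁻¹ x))
    (huniq : ∀ x y, p x → p (g x) → p y → p (g y) → x = y)
    {a b : α} (ha : ¬ p a) (hb : ¬ p b) (hab : a ≠ b) : ¬ IsMultFree (evenEven p) := by
  intro hmf
  obtain ⟨h₁, m₁, h₂, m₂, h₃, m₃, h⟩ := hmf.exists_mul_eq (swap a b) g
  have hs : swap a b ∈ blockStab p := swap_mem_blockStab (by tauto)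
  obtain ⟨s₁, -, e₁⟩ := mem_evenEven.1 m₁
  obtain ⟨s₂, e₂, -⟩ := mem_evenEven.1 m₂
  obtain ⟨s₃, e₃, -⟩ := mem_evenEven.1 m₃
  let x : blockStab p := ⟨h₂, s₂⟩ * ⟨swap a b, hs⟩ * ⟨h₃, s₃⟩
  let y : blockStab p := ⟨h₁, s₁⟩⁻¹ * ⟨swap a b, hs⟩
  have hx : Perm.sign (restrictBlock p x) = 1 := by
    simp only [MonoidHom.comp_apply] at e₂ e₃
    simp only [x, map_mul, e₂, e₃, restrictBlock_swap ha hb, mul_one]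
  have hy : Perm.sign (restrictCoblock p y) = -1 := by
    simp only [MonoidHom.comp_apply] at e₁
    simp only [y, map_mul, map_inv, e₁, sign_restrictCoblock_swap ha hb hab, inv_one, one_mul]
  have hxy : ∀ i, g ((x : Perm α) i) = (y : Perm α) (g i) := by
    intro i
    have h' : g * (h₂ * swap a b * h₃) = h₁⁻¹ * swap a b * g := by
      rw [mul_assoc h₁⁻¹, ← h]; group
    exact Perm.ext_iff.1 h' i
  have hxp := x.2
  have hyp := y.2
  have heq : Perm.sign (restrictCoblock p y) = Perm.sign (restrictBlock p x) := by
    refine Perm.sign_bij (fun i _ => ⟨g⁻¹ i, hg i i.2⟩) ?_ ?_ ?_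
    · rintro ⟨i, hi⟩ _ _
      apply Subtype.ext
      apply g.injective
      have := hxy (g⁻¹ i)
      rw [show g (g⁻¹ i) = i by simp] at this
      simpa [restrictBlock, restrictCoblock] using this.symm
    · rintro ⟨i, hi⟩ ⟨j, hj⟩ _ _ hij
      simpa using hij
    · rintro ⟨i, hi⟩ hne
      have hne' : (x : Perm α) i ≠ i := fun h => hne (Subtype.ext h)
      have hgi : ¬ p (g i) := by
        intro hgi
        apply hne'
        refine huniq _ _ ((hxp i).1 hi) ?_ hi hgi
        rw [hxy]
        exact (hyp _).1 hgi
      refine ⟨⟨g i, hgi⟩, fun h => hne' ?_, by simp⟩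
      apply g.injective
      rw [hxy]
      exact congrArg Subtype.val h
  rw [hx, hy] at heq
  exact absurd heq (by decide)

end blockStab

theorem stmt4 (n k : ℕ) (hn : 20 ≤ n) (hk : 2 ≤ k) (hkn : 2 * k ≤ n) :
    IsMultFree (evenEven (fun i : Fin n => (i : ℕ) < n - k)) ↔ (3 ≤ k ∧ 2 * k + 2 ≤ n) := by
  have hp : (Finset.univ.filter fun i : Fin n => (i : ℕ) < n - k).card = n - k := by
    rw [Fin.card_filter_val_lt]
    omega
  have hq : (Finset.univ.filter fun i : Fin n => ¬ (i : ℕ) < n - k).card = k := by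
    have := Finset.card_filter_add_card_filter_not (s := Finset.univ)
      (fun i : Fin n => (i : ℕ) < n - k)
    rw [hp, Finset.card_univ, Fintype.card_fin] at this
    omega
  constructor
  · intro hmf
    by_contra hc
    by_cases h2 : k = 2
    · refine not_isMultFree_evenEven_of_card_eq_two (a := ⟨0, by omega⟩) (x := ⟨n - 2, by omega⟩)
        (y := ⟨n - 1, by omega⟩) ?_ ?_ ?_ ?_ ?_ hmf
      · simp only; omega
      · simp only; omega
      · simp only; omega
      · simp only [ne_eq, Fin.mk.injEq]; omega
      · intro z hz
        simp only [Fin.ext_iff]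
        have := z.2
        omega
    · refine not_isMultFree_evenEven_of_swap Fin.revPerm ?_ ?_ (a := ⟨n - 2, by omega⟩)
        (b := ⟨n - 1, by omega⟩) ?_ ?_ ?_ hmf
      · intro x hx
        change ((Fin.revPerm.symm x : Fin n) : ℕ) < n - k
        rw [Fin.revPerm_symm]
        simp only [Fin.revPerm_apply, Fin.val_rev]
        have := x.2
        omega
      · intro x y hx hx' hy hy'
        simp only [Fin.revPerm_apply, Fin.val_rev] at hx' hy'
        apply Fin.ext
        have := x.2
        have := y.2
        omega
      · simp only; omega
      · simp only; omega
      · simp only [ne_eq, Fin.mk.injEq]; omega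
  · rintro ⟨h3, h4⟩
    apply isMultFree_evenEven
    · rw [hq]; exact h3
    · rw [hp, hq]; omega
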